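/- arXiv:1807.10155 — 2 statements merged into one kernel-verified Lean document; each statement's English description precedes it below -/
import Mathlib

section
/- Let (X,T) be a transitive topological dynamical system that is disjoint from every minimal topological dynamical system. Then (X,T) is weakly mixing and there exists a countable dense subset D of X such that for every nonempty open set U ⊆ X and every dynamical syndetic set B ⊆ ℤ₊ there is a point x ∈ D ∩ U (depending only on U and B) such that for every thick set A ⊆ ℤ₊ one has N_T(x,U) ∩ (A ∩ B) ≠ ∅. -/
open Set Function Filter Topology

structure TDS where
  carrier : Type
  [ms : MetricSpace carrier]
  [cs : CompactSpace carrier]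
  map : carrier → carrier
  cont : Continuous map
  surj : Function.Surjective map

attribute [instance] TDS.ms TDS.cs

def orbit {X : Type*} (T : X → X) (x : X) : Set X :=
  Set.range fun n : ℕ => T^[n] x

def IsMinimalSys {Y : Type*} [TopologicalSpace Y] (S : Y → Y) : Prop :=
  ∀ y : Y, Dense (orbit S y)

def IsTransitiveSys {X : Type*} [TopologicalSpace X] (T : X → X) : Prop :=
  ∀ U V : Set X, IsOpen U → IsOpen V → U.Nonempty → V.Nonempty →
    {n : ℕ | (U ∩ T^[n] ⁻¹' V).Nonempty}.Infinite

def IsWeaklyMixingSys {X : Type*} [TopologicalSpace X] (T : X → X) : Prop :=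
  IsTransitiveSys fun p : X × X => (T p.1, T p.2)

def IsJoining {X Y : Type*} [TopologicalSpace X] [TopologicalSpace Y]
    (T : X → X) (S : Y → Y) (J : Set (X × Y)) : Prop :=
  J.Nonempty ∧ IsClosed J ∧ (∀ p ∈ J, (T p.1, S p.2) ∈ J) ∧
    Prod.fst '' J = Set.univ ∧ Prod.snd '' J = Set.univ

def DisjointSys {X Y : Type*} [TopologicalSpace X] [TopologicalSpace Y]
    (T : X → X) (S : Y → Y) : Prop :=
  ∀ J : Set (X × Y), IsJoining T S J → J = Set.univ

def Syndetic (A : Set ℕ) : Prop :=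
  ∃ N : ℕ, ∀ i : ℕ, ∃ j ≤ N, i + j ∈ A

def Thick (A : Set ℕ) : Prop :=
  ∀ L : ℕ, ∃ n : ℕ, ∀ j ≤ L, n + j ∈ A

def IsMinimalPoint {X : Type*} [TopologicalSpace X] (T : X → X) (x : X) : Prop :=
  ∀ y ∈ closure (orbit T x), closure (orbit T x) ⊆ closure (orbit T y)

def Proximal {X : Type*} [MetricSpace X] (T : X → X) (x y : X) : Prop :=
  ∃ u : ℕ → ℕ, Filter.Tendsto (fun i => dist (T^[u i] x) (T^[u i] y)) Filter.atTop (nhds 0)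

def IsDistalPoint {X : Type*} [MetricSpace X] (T : X → X) (x : X) : Prop :=
  ∀ y ∈ closure (orbit T x), Proximal T x y → y = x

def DynSyndetic (B : Set ℕ) : Prop :=
  ∃ 𝒴 : TDS, IsMinimalSys 𝒴.map ∧
    ∃ (y : 𝒴.carrier) (V : Set 𝒴.carrier),
      IsOpen V ∧ y ∈ V ∧ {n : ℕ | 𝒴.map^[n] y ∈ V} ⊆ B

def CentralSet (S : Set ℕ) : Prop :=
  ∃ 𝒵 : TDS, ∃ (z w : 𝒵.carrier) (W : Set 𝒵.carrier),
    IsMinimalPoint 𝒵.map w ∧ Proximal 𝒵.map z w ∧ IsOpen W ∧ w ∈ W ∧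
    {n : ℕ | 𝒵.map^[n] z ∈ W} ⊆ S

def CStarSet (A : Set ℕ) : Prop :=
  ∀ S : Set ℕ, CentralSet S → (A ∩ S).Nonempty

section Dynamics

variable {X Y : Type*} [TopologicalSpace X] [TopologicalSpace Y]

/-- Pairs whose simultaneous orbit never visits `U × V`. -/
def avoidSet (T : X → X) (S : Y → Y) (U : Set X) (V : Set Y) : Set (X × Y) :=
  {p | ∀ n : ℕ, ¬ (T^[n] p.1 ∈ U ∧ S^[n] p.2 ∈ V)}

lemma isClosed_avoidSet {T : X → X} {S : Y → Y} (hT : Continuous T) (hS : Continuous S)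
    {U : Set X} {V : Set Y} (hU : IsOpen U) (hV : IsOpen V) :
    IsClosed (avoidSet T S U V) := by
  have h : avoidSet T S U V =
      ⋂ n : ℕ, ({p : X × Y | T^[n] p.1 ∈ U} ∩ {p : X × Y | S^[n] p.2 ∈ V})ᶜ := by
    ext p
    simp [avoidSet]
  rw [h]
  refine isClosed_iInter fun n => IsOpen.isClosed_compl (IsOpen.inter ?_ ?_)
  · exact hU.preimage ((hT.iterate n).comp continuous_fst)
  · exact hV.preimage ((hS.iterate n).comp continuous_snd)

omit [TopologicalSpace X] [TopologicalSpace Y] in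
lemma map_mem_avoidSet {T : X → X} {S : Y → Y} {U : Set X} {V : Set Y} {p : X × Y}
    (hp : p ∈ avoidSet T S U V) : (T p.1, S p.2) ∈ avoidSet T S U V := fun n => by
  simpa only [← iterate_succ_apply] using hp (n + 1)

lemma mem_of_mem_closure_orbit {T : X → X} {K : Set X} (hK : IsClosed K) (hTK : MapsTo T K K)
    {x z : X} (hz : z ∈ K) (hx : x ∈ closure (orbit T z)) : x ∈ K := by
  refine closure_minimal ?_ hK hx
  rintro _ ⟨n, rfl⟩
  exact hTK.iterate n hz

lemma mapsTo_closure_orbit {T : X → X} (hT : Continuous T) (x : X) :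
    MapsTo T (closure (orbit T x)) (closure (orbit T x)) := by
  refine MapsTo.closure ?_ hT
  rintro _ ⟨n, rfl⟩
  exact ⟨n + 1, iterate_succ_apply' T n x⟩

omit [TopologicalSpace X] in
lemma self_mem_orbit (T : X → X) (x : X) : x ∈ orbit T x := ⟨0, rfl⟩

omit [TopologicalSpace X] [TopologicalSpace Y] in
lemma mapsTo_fst_image_avoidSet (T : X → X) (S : Y → Y) (U : Set X) (V : Set Y) :
    MapsTo T (Prod.fst '' avoidSet T S U V) (Prod.fst '' avoidSet T S U V) := by
  rintro _ ⟨p, hp, rfl⟩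
  exact ⟨_, map_mem_avoidSet hp, rfl⟩

variable [CompactSpace X] [CompactSpace Y] [T2Space X] [T2Space Y]

omit [T2Space Y] in
lemma isClosed_fst_image_avoidSet {T : X → X} {S : Y → Y} (hT : Continuous T)
    (hS : Continuous S) {U : Set X} {V : Set Y} (hU : IsOpen U) (hV : IsOpen V) :
    IsClosed (Prod.fst '' avoidSet T S U V) :=
  ((isClosed_avoidSet hT hS hU hV).isCompact.image continuous_fst).isClosed

omit [T2Space X] in
lemma isClosed_snd_image_avoidSet {T : X → X} {S : Y → Y} (hT : Continuous T)
    (hS : Continuous S) {U : Set X} {V : Set Y} (hU : IsOpen U) (hV : IsOpen V) :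
    IsClosed (Prod.snd '' avoidSet T S U V) :=
  ((isClosed_avoidSet hT hS hU hV).isCompact.image continuous_snd).isClosed

/-- If `T` is transitive and disjoint from the minimal map `S`, then the points whose orbit can
avoid `U` along the visits to `V` of some orbit of `S` are nowhere dense. -/
lemma DisjointSys.not_subset_closure {T : X → X} {S : Y → Y} (hT : Continuous T)
    (hS : Continuous S) (hTtr : IsTransitiveSys T) (hmin : IsMinimalSys S)
    (hdisj : DisjointSys T S) {U G : Set X} {V : Set Y} (hU : IsOpen U) (hV : IsOpen V)
    (hUn : U.Nonempty) (hVn : V.Nonempty) (hG : IsOpen G) (hGn : G.Nonempty)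
    (hsub : G ⊆ closure {x | ∃ w : Y, ∀ n : ℕ, ¬ (T^[n] x ∈ U ∧ S^[n] w ∈ V)}) : False := by
  have hcl := isClosed_fst_image_avoidSet hT hS hU hV
  have hset : {x | ∃ w : Y, ∀ n : ℕ, ¬ (T^[n] x ∈ U ∧ S^[n] w ∈ V)} =
      Prod.fst '' avoidSet T S U V := by
    ext x
    simp [avoidSet]
  rw [hset, hcl.closure_eq] at hsub
  have hfst : Prod.fst '' avoidSet T S U V = univ := by
    rw [← hcl.closure_eq]
    refine eq_univ_of_forall fun x => mem_closure_iff.2 fun O hO hxO => ?_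
    obtain ⟨n, z, hzG, hzO⟩ := (hTtr G O hG hO hGn ⟨x, hxO⟩).nonempty
    exact ⟨_, hzO, (mapsTo_fst_image_avoidSet T S U V).iterate n (hsub hzG)⟩
  obtain ⟨u, hu⟩ := hUn
  obtain ⟨v, hv⟩ := hVn
  have hne : (avoidSet T S U V).Nonempty := by
    have : u ∈ Prod.fst '' avoidSet T S U V := hfst ▸ mem_univ u
    obtain ⟨p, hp, -⟩ := this
    exact ⟨p, hp⟩
  have hsnd : Prod.snd '' avoidSet T S U V = univ := by
    obtain ⟨p, hp⟩ := hne
    refine eq_univ_of_forall fun y => mem_of_mem_closure_orbit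
      (isClosed_snd_image_avoidSet hT hS hU hV) (T := S) ?_ (z := p.2) ⟨p, hp, rfl⟩
      (hmin p.2 y)
    rintro _ ⟨q, hq, rfl⟩
    exact ⟨_, map_mem_avoidSet hq, rfl⟩
  have huniv := hdisj _ ⟨hne, isClosed_avoidSet hT hS hU hV, fun p hp => map_mem_avoidSet hp,
    hfst, hsnd⟩
  have huv : (u, v) ∈ avoidSet T S U V := huniv ▸ mem_univ _
  exact huv 0 ⟨hu, hv⟩

omit [T2Space Y] in
/-- If `N(x, U) ∩ N(y, V)` misses a thick set and `x` is a minimal point, then `N(x, U) ∩ N(w, V)`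
is empty for some `w`. -/
lemma IsMinimalPoint.exists_avoid {T : X → X} {S : Y → Y} (hT : Continuous T)
    (hS : Continuous S) {x : X} (hx : IsMinimalPoint T x) {y : Y} {U : Set X} {V : Set Y}
    (hU : IsOpen U) (hV : IsOpen V) {A : Set ℕ} (hA : Thick A)
    (h : ∀ n ∈ A, ¬ (T^[n] x ∈ U ∧ S^[n] y ∈ V)) :
    ∃ w : Y, ∀ n : ℕ, ¬ (T^[n] x ∈ U ∧ S^[n] w ∈ V) := by
  choose m hm using hA
  let f : ℕ → X × Y := fun L => (T^[m L] x, S^[m L] y)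
  obtain ⟨p, -, hp⟩ := isCompact_univ.exists_mapClusterPt (f := atTop) (u := f) (by simp)
  have hp1 : p ∈ avoidSet T S U V := by
    intro n hn
    have hopen : IsOpen {q : X × Y | T^[n] q.1 ∈ U ∧ S^[n] q.2 ∈ V} :=
      (hU.preimage ((hT.iterate n).comp continuous_fst)).inter
        (hV.preimage ((hS.iterate n).comp continuous_snd))
    have hfreq := hp.frequently (hopen.mem_nhds hn)
    obtain ⟨L, hLn, hL1, hL2⟩ := (frequently_atTop.1 hfreq) n
    refine h _ (hm L n hLn) ⟨?_, ?_⟩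
    · rw [add_comm, iterate_add_apply]; exact hL1
    · rw [add_comm, iterate_add_apply]; exact hL2
  have hp2 : p.1 ∈ closure (orbit T x) := by
    refine mem_closure_iff.2 fun O hO hpO => ?_
    have hfreq := hp.frequently ((hO.preimage continuous_fst).mem_nhds hpO)
    obtain ⟨L, hL⟩ := hfreq.exists
    exact ⟨_, hL, m L, rfl⟩
  have hxp : x ∈ closure (orbit T p.1) :=
    hx p.1 hp2 (subset_closure (self_mem_orbit T x))
  obtain ⟨q, hq, hqx⟩ := mem_of_mem_closure_orbit (isClosed_fst_image_avoidSet hT hS hU hV)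
    (mapsTo_fst_image_avoidSet T S U V) ⟨p, hp1, rfl⟩ hxp
  exact ⟨q.2, by subst hqx; exact hq⟩

omit [CompactSpace Y] [T2Space X] [T2Space Y] [TopologicalSpace Y]

lemma exists_isMinimalPoint_mem {T : X → X} (hT : Continuous T) {K : Set X} (hK : IsClosed K)
    (hKn : K.Nonempty) (hTK : MapsTo T K K) : ∃ x ∈ K, IsMinimalPoint T x := by
  let 𝒮 : Set (Set X) := {C | IsClosed C ∧ C.Nonempty ∧ MapsTo T C C}
  obtain ⟨M, hMK, hM⟩ := zorn_superset_nonempty 𝒮 (fun c hc hchain hcn => by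
    refine ⟨⋂₀ c, ⟨isClosed_sInter fun C hC => (hc hC).1, ?_, ?_⟩,
      fun C hC => sInter_subset_of_mem hC⟩
    · have := hcn.to_subtype
      refine IsCompact.nonempty_sInter_of_directed_nonempty_isCompact_isClosed ?_
        (fun C hC => (hc hC).2.1) (fun C hC => (hc hC).1.isCompact) fun C hC => (hc hC).1
      intro A hA B hB
      rcases hchain.total hA hB with h | h
      · exact ⟨A, hA, subset_rfl, h⟩
      · exact ⟨B, hB, h, subset_rfl⟩
    · exact fun z hz C hC => (hc hC).2.2 (hz C hC)) K ⟨hK, hKn, hTK⟩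
  obtain ⟨x, hx⟩ := hM.prop.2.1
  refine ⟨x, hMK hx, fun y hy => ?_⟩
  have hyM := mem_of_mem_closure_orbit hM.prop.1 hM.prop.2.2 hx hy
  have hsub : closure (orbit T y) ⊆ M :=
    fun z hz => mem_of_mem_closure_orbit hM.prop.1 hM.prop.2.2 hyM hz
  have hle : M ⊆ closure (orbit T y) :=
    hM.le_of_le ⟨isClosed_closure, ⟨y, subset_closure (self_mem_orbit T y)⟩,
      mapsTo_closure_orbit hT y⟩ hsub
  exact fun z hz => hle (mem_of_mem_closure_orbit hM.prop.1 hM.prop.2.2 hx hz)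

end Dynamics

section Words

variable {α : Type*}

lemma List.exists_pair_infix_of_infix_flatten {W : Set (List α)} (hW : W.Nonempty)
    {u : List α} {l : List (List α)} (hl : ∀ w ∈ l, w ∈ W) (hlen : ∀ w ∈ W, u.length ≤ w.length)
    (hu : u <:+: l.flatten) : ∃ w₁ ∈ W, ∃ w₂ ∈ W, u <:+: w₁ ++ w₂ := by
  obtain ⟨w₀, hw₀⟩ := hW
  induction l with
  | nil =>
    have hnil : u = [] := by simpa using hu
    exact ⟨w₀, hw₀, w₀, hw₀, hnil ▸ List.nil_infix⟩
  | cons w l ih =>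
    have hwW : w ∈ W := hl w (by simp)
    rw [List.flatten_cons, List.infix_append_iff] at hu
    rcases hu with hu | hu | ⟨t₁, t₂, rfl, ht₁, ht₂⟩
    · exact ⟨w, hwW, w, hwW, hu.trans (List.prefix_append w w).isInfix⟩
    · exact ih (fun v hv => hl v (by simp [hv])) hu
    · cases l with
      | nil =>
        have hnil : t₂ = [] := by simpa using ht₂
        subst hnil
        refine ⟨w, hwW, w, hwW, ?_⟩
        rw [List.append_nil]
        exact ht₁.isInfix.trans (List.prefix_append w w).isInfix
      | cons w' l =>
        have hw'W : w' ∈ W := hl w' (by simp)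
        refine ⟨w, hwW, w', hw'W, ?_⟩
        have hlen' := hlen w' hw'W
        rw [List.length_append] at hlen'
        have hpre : t₂ <+: w' := List.prefix_of_prefix_length_le ht₂
          (by rw [List.flatten_cons]; exact List.prefix_append _ _) (by omega)
        exact List.infix_append_iff.2 (Or.inr (Or.inr ⟨t₁, t₂, rfl, ht₁, hpre⟩))

lemma List.exists_mem_infix_of_infix_flatten {K : ℕ} (hK : 0 < K)
    {u : List α} {l : List (List α)} (hlen : ∀ w ∈ l, w.length ≤ K)
    (hu : u <:+: l.flatten) (hu2 : 2 * K ≤ u.length) : ∃ w ∈ l, w <:+: u := by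
  induction l with
  | nil =>
    have hnil : u = [] := by simpa using hu
    simp [hnil] at hu2
    omega
  | cons w l ih =>
    have hwK := hlen w (by simp)
    rw [List.flatten_cons, List.infix_append_iff] at hu
    rcases hu with hu | hu | ⟨t₁, t₂, rfl, ht₁, ht₂⟩
    · have := hu.length_le
      omega
    · obtain ⟨v, hv, hvu⟩ := ih (fun v hv => hlen v (by simp [hv])) hu
      exact ⟨v, by simp [hv], hvu⟩
    · have h₁ := ht₁.length_le
      rw [List.length_append] at hu2
      cases l with
      | nil =>
        have hnil : t₂ = [] := by simpa using ht₂
        simp [hnil] at hu2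
        omega
      | cons w' l =>
        have hw'K := hlen w' (by simp)
        have hpre : w' <+: t₂ := List.prefix_of_prefix_length_le
          (by rw [List.flatten_cons]; exact List.prefix_append _ _) ht₂ (by omega)
        exact ⟨w', by simp, hpre.isInfix.trans (List.suffix_append t₁ t₂).isInfix⟩

/-- `u` is a factor of a concatenation of words from `W`. -/
def IsLegal (W : Set (List α)) (u : List α) : Prop :=
  ∃ l : List (List α), (∀ w ∈ l, w ∈ W) ∧ u <:+: l.flatten

lemma IsLegal.of_infix {W : Set (List α)} {u v : List α} (hv : IsLegal W v) (h : u <:+: v) :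
    IsLegal W u := by
  obtain ⟨l, hl, hlv⟩ := hv
  exact ⟨l, hl, h.trans hlv⟩

/-- Every word of `V` is a concatenation of words of `W` and contains all products of two words
of `W`. -/
def Refines (W V : Set (List α)) : Prop :=
  ∀ v ∈ V, (∃ l : List (List α), (∀ w ∈ l, w ∈ W) ∧ l.flatten = v) ∧
    ∀ w₁ ∈ W, ∀ w₂ ∈ W, w₁ ++ w₂ <:+: v

lemma Refines.exists_flatten {W V : Set (List α)} (h : Refines W V) {l : List (List α)}
    (hl : ∀ v ∈ l, v ∈ V) : ∃ l' : List (List α), (∀ w ∈ l', w ∈ W) ∧ l'.flatten = l.flatten := by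
  induction l with
  | nil => exact ⟨[], by simp, rfl⟩
  | cons v l ih =>
    obtain ⟨l₁, h₁, h₁'⟩ := ih fun v hv => hl v (by simp [hv])
    obtain ⟨l₂, h₂, h₂'⟩ := (h v (hl v (by simp))).1
    refine ⟨l₂ ++ l₁, fun w hw => ?_, by simp [h₁', h₂']⟩
    rcases List.mem_append.1 hw with hw | hw
    exacts [h₂ w hw, h₁ w hw]

lemma IsLegal.of_refines {W V : Set (List α)} (h : Refines W V) {u : List α}
    (hu : IsLegal V u) : IsLegal W u := by
  obtain ⟨l, hl, hlu⟩ := hu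
  obtain ⟨l', hl', hll'⟩ := h.exists_flatten hl
  exact ⟨l', hl', hll' ▸ hlu⟩

/-- The prefix of length `n` of a sequence. -/
def seqPrefix (η : ℕ → α) (n : ℕ) : List α := List.ofFn fun i : Fin n => η i

@[simp] lemma length_seqPrefix (η : ℕ → α) (n : ℕ) : (seqPrefix η n).length = n := by
  simp [seqPrefix]

lemma getElem?_seqPrefix (η : ℕ → α) {n i : ℕ} (hi : i < n) :
    (seqPrefix η n)[i]? = some (η i) := by
  simp [seqPrefix, hi]

lemma seqPrefix_prefix (η : ℕ → α) {m n : ℕ} (h : m ≤ n) :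
    seqPrefix η m <+: seqPrefix η n := by
  rw [List.prefix_iff_getElem?]
  intro i hi
  rw [length_seqPrefix] at hi
  rw [getElem?_seqPrefix η (hi.trans_le h), ← getElem?_seqPrefix η hi]
  simp

lemma seqPrefix_shift_infix (η : ℕ → α) (n : ℕ) :
    seqPrefix (fun i => η (i + 1)) n <:+: seqPrefix η (n + 1) := by
  have h : seqPrefix η (n + 1) = η 0 :: seqPrefix (fun i => η (i + 1)) n := by
    simp [seqPrefix, List.ofFn_succ]
  rw [h]
  exact (List.suffix_cons _ _).isInfix

lemma exists_of_infix_seqPrefix {η : ℕ → α} {u : List α} {n : ℕ} (h : u <:+: seqPrefix η n) :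
    ∃ m, ∀ i < u.length, u[i]? = some (η (m + i)) := by
  obtain ⟨s, t, hst⟩ := h
  refine ⟨s.length, fun i hi => ?_⟩
  have hlen := congrArg List.length hst
  simp only [List.length_append, length_seqPrefix] at hlen
  rw [← getElem?_seqPrefix η (n := n) (by omega), ← hst, List.append_assoc,
    List.getElem?_append_right (by omega), Nat.add_sub_cancel_left,
    List.getElem?_append_left hi]

lemma isClosed_setOf_seqPrefix [TopologicalSpace α] [DiscreteTopology α] (n : ℕ)
    (P : List α → Prop) : IsClosed {η : ℕ → α | P (seqPrefix η n)} := by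
  have hc : Continuous fun (η : ℕ → α) (i : Fin n) => η i := by fun_prop
  exact (isClosed_discrete {f : Fin n → α | P (List.ofFn f)}).preimage hc

/-- The sequences all of whose factors are legal at every level. -/
def substShift (W : ℕ → Set (List α)) : Set (ℕ → α) :=
  {η | ∀ n, IsLegal (W n) (seqPrefix η n)}

variable {W : ℕ → Set (List α)}

lemma IsLegal.of_le (hW : ∀ k, Refines (W k) (W (k + 1))) {u : List α} {k m : ℕ} (h : k ≤ m)
    (hu : IsLegal (W m) u) : IsLegal (W k) u := by
  induction m, h using Nat.le_induction with
  | base => exact hu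
  | succ m _ ih => exact ih (hu.of_refines (hW m))

lemma isLegal_of_mem_substShift (hW : ∀ k, Refines (W k) (W (k + 1))) {η : ℕ → α}
    (hη : η ∈ substShift W) (k n : ℕ) : IsLegal (W k) (seqPrefix η n) :=
  ((hη (max k n)).of_le hW (le_max_left k n)).of_infix
    (seqPrefix_prefix η (le_max_right k n)).isInfix

lemma isClosed_substShift [TopologicalSpace α] [DiscreteTopology α] :
    IsClosed (substShift W) := by
  have h : substShift W = ⋂ n, {η | IsLegal (W n) (seqPrefix η n)} := by
    ext η
    simp [substShift]
  rw [h]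
  exact isClosed_iInter fun n => isClosed_setOf_seqPrefix n _

/-- The one-sided shift. -/
def seqShift (η : ℕ → α) : ℕ → α := fun i => η (i + 1)

lemma iterate_seqShift (η : ℕ → α) (n i : ℕ) : (seqShift^[n] η) i = η (n + i) := by
  induction n generalizing η with
  | zero => simp
  | succ n ih => rw [iterate_succ_apply, ih, seqShift]; congr 1; omega

lemma mapsTo_seqShift (hW : ∀ k, Refines (W k) (W (k + 1))) :
    MapsTo seqShift (substShift W) (substShift W) := fun η hη n =>
  (isLegal_of_mem_substShift hW hη n (n + 1)).of_infix (seqPrefix_shift_infix η n)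

lemma le_length_of_refines (hW : ∀ k, Refines (W k) (W (k + 1))) (hne : ∀ k, (W k).Nonempty)
    (hnil : ∀ k, [] ∉ W k) (k : ℕ) : ∀ w ∈ W k, k + 1 ≤ w.length := by
  induction k with
  | zero =>
    intro w hw
    have : w ≠ [] := fun h => hnil 0 (h ▸ hw)
    have := List.length_pos_iff.2 this
    omega
  | succ k ih =>
    intro v hv
    obtain ⟨w, hw⟩ := hne k
    have h₁ := ((hW k v hv).2 w hw w hw).length_le
    have h₂ := ih w hw
    rw [List.length_append] at h₁
    omega

lemma exists_pair_infix_seqPrefix (hW : ∀ k, Refines (W k) (W (k + 1)))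
    (hfin : ∀ k, (W k).Finite) {η : ℕ → α} (hη : η ∈ substShift W) (k : ℕ) :
    ∃ n, ∀ w₁ ∈ W k, ∀ w₂ ∈ W k, w₁ ++ w₂ <:+: seqPrefix η n := by
  obtain ⟨K, hK⟩ := ((hfin (k + 1)).image List.length).bddAbove
  obtain ⟨l, hl, hlu⟩ := isLegal_of_mem_substShift hW hη (k + 1) (2 * (K + 1))
  obtain ⟨v, hv, hvu⟩ := List.exists_mem_infix_of_infix_flatten (K := K + 1) (by omega)
    (fun w hw => (hK (mem_image_of_mem _ (hl w hw))).trans (by omega)) hlu (by simp)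
  exact ⟨_, fun w₁ h₁ w₂ h₂ => ((hW k v (hl v hv)).2 w₁ h₁ w₂ h₂).trans hvu⟩

lemma mem_closure_orbit_seqShift [TopologicalSpace α] [DiscreteTopology α]
    (hW : ∀ k, Refines (W k) (W (k + 1)))
    (hfin : ∀ k, (W k).Finite) (hne : ∀ k, (W k).Nonempty) (hnil : ∀ k, [] ∉ W k)
    {η ζ : ℕ → α} (hη : η ∈ substShift W) (hζ : ζ ∈ substShift W) :
    ζ ∈ closure (orbit seqShift η) := by
  have key : ∀ n, ∃ m, ∀ i < n, η (m + i) = ζ i := by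
    intro n
    obtain ⟨l, hl, hlu⟩ := hζ n
    obtain ⟨w₁, hw₁, w₂, hw₂, hw⟩ := List.exists_pair_infix_of_infix_flatten (hne n) hl
      (fun w hw => by
        have := le_length_of_refines hW hne hnil n w hw
        rw [length_seqPrefix]; omega) hlu
    obtain ⟨M, hM⟩ := exists_pair_infix_seqPrefix hW hfin hη n
    obtain ⟨m, hm⟩ := exists_of_infix_seqPrefix (hw.trans (hM w₁ hw₁ w₂ hw₂))
    refine ⟨m, fun i hi => ?_⟩
    have := hm i (by simpa using hi)
    rw [getElem?_seqPrefix ζ hi] at this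
    exact (Option.some.inj this).symm
  choose m hm using key
  refine mem_closure_of_tendsto (f := fun n => seqShift^[m n] η) (b := atTop) ?_
    (Eventually.of_forall fun n => ⟨m n, rfl⟩)
  refine tendsto_pi_nhds.2 fun i => tendsto_const_nhds.congr' ?_
  filter_upwards [eventually_gt_atTop i] with n hn
  rw [iterate_seqShift, hm n i hn]

end Words

section Coding

variable {X : Type*} {T : X → X} {U : Set X}

/-- The word `w` only has the letter `true` at times when the orbit of `x` is outside `U`. -/
def Compatible (T : X → X) (U : Set X) (x : X) (w : List Bool) : Prop :=
  ∀ i : ℕ, w[i]? = some true → T^[i] x ∉ U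

lemma Compatible.append {x : X} {u v : List Bool} (hu : Compatible T U x u)
    (hv : Compatible T U (T^[u.length] x) v) : Compatible T U x (u ++ v) := by
  intro i hi
  rcases lt_or_ge i u.length with h | h
  · rw [List.getElem?_append_left h] at hi
    exact hu i hi
  · rw [List.getElem?_append_right h] at hi
    have := hv _ hi
    rwa [← iterate_add_apply, Nat.sub_add_cancel h] at this

lemma Compatible.of_prefix {x : X} {u v : List Bool} (hv : Compatible T U x v) (h : u <+: v) :
    Compatible T U x u := by
  intro i hi
  obtain ⟨t, rfl⟩ := h
  refine hv i ?_
  have hlt : i < u.length := (List.getElem?_eq_some_iff.1 hi).1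
  rw [List.getElem?_append_left hlt, hi]

lemma exists_compatible_flatten {W : Set (List Bool)} (hnil : [] ∉ W)
    (hW : ∀ x : X, ∃ w ∈ W, Compatible T U x w) {m : ℕ} (hm : ∀ w ∈ W, w.length ≤ m)
    (x : X) (n : ℕ) : ∃ l : List (List Bool), (∀ w ∈ l, w ∈ W) ∧ n ≤ l.flatten.length ∧
      l.flatten.length ≤ n + m ∧ Compatible T U x l.flatten := by
  induction n with
  | zero => exact ⟨[], by simp, by simp, by simp, fun i hi => by simp at hi⟩
  | succ n ih =>
    obtain ⟨l, hl, h₁, h₂, h₃⟩ := ih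
    by_cases h : n + 1 ≤ l.flatten.length
    · exact ⟨l, hl, h, by omega, h₃⟩
    · obtain ⟨w, hw, hxw⟩ := hW (T^[l.flatten.length] x)
      have hpos : 0 < w.length := List.length_pos_iff.2 fun h0 => hnil (h0 ▸ hw)
      have hlen := hm w hw
      have hflat : (l ++ [w]).flatten = l.flatten ++ w := by simp
      refine ⟨l ++ [w], fun v hv => ?_, ?_, ?_, ?_⟩
      · rcases List.mem_append.1 hv with hv | hv
        · exact hl v hv
        · rwa [List.mem_singleton.1 hv]
      · rw [hflat, List.length_append]; omega
      · rw [hflat, List.length_append]; omega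
      · rw [hflat]; exact h₃.append hxw

/-- A finite code of nonempty words, one of which is compatible with each point. -/
structure IsCode (T : X → X) (U : Set X) (W : Set (List Bool)) : Prop where
  finite : W.Finite
  nonempty : W.Nonempty
  nil_notMem : [] ∉ W
  exists_compatible : ∀ x : X, ∃ w ∈ W, Compatible T U x w

lemma exists_list_pairs_infix {W : Set (List Bool)} (hW : W.Finite) :
    ∃ l : List (List Bool), (∀ w ∈ l, w ∈ W) ∧
      ∀ w₁ ∈ W, ∀ w₂ ∈ W, w₁ ++ w₂ <:+: l.flatten := by
  have h : ∀ s : List (List Bool × List Bool), (∀ p ∈ s, p.1 ∈ W ∧ p.2 ∈ W) →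
      ∃ l : List (List Bool), (∀ w ∈ l, w ∈ W) ∧ ∀ p ∈ s, p.1 ++ p.2 <:+: l.flatten := by
    intro s hs
    induction s with
    | nil => exact ⟨[], by simp, by simp⟩
    | cons p s ih =>
      obtain ⟨l, hl, hls⟩ := ih fun q hq => hs q (by simp [hq])
      have hp := hs p (by simp)
      have hflat : (p.1 :: p.2 :: l).flatten = (p.1 ++ p.2) ++ l.flatten := by simp
      refine ⟨p.1 :: p.2 :: l, ?_, ?_⟩
      · simpa [hp.1, hp.2] using hl
      · rw [hflat]
        intro q hq
        rcases List.mem_cons.1 hq with rfl | hq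
        · exact (List.prefix_append _ _).isInfix
        · exact (hls q hq).trans (List.suffix_append _ _).isInfix
  obtain ⟨l, hl, hls⟩ := h (hW.prod hW).toFinset.toList (by simp)
  exact ⟨l, hl, fun w₁ h₁ w₂ h₂ => hls (w₁, w₂) (by simp [h₁, h₂])⟩

lemma IsCode.exists_refines [Nonempty X] {W : Set (List Bool)} (hW : IsCode T U W)
    (hU : ∀ L : ℕ, ∃ N : ℕ, ∀ x : X, ∃ n ≤ N, ∀ i < L, T^[n + i] x ∉ U) :
    ∃ V, IsCode T U V ∧ Refines W V := by
  obtain ⟨a, ha, hpairs⟩ := exists_list_pairs_infix hW.finite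
  obtain ⟨m, hm⟩ := (hW.finite.image List.length).bddAbove
  obtain ⟨N, hN⟩ := hU (a.flatten.length + m)
  let V : Set (List Bool) := {v | v.length ≤ N + m + a.flatten.length ∧
    (∃ l : List (List Bool), (∀ w ∈ l, w ∈ W) ∧ l.flatten = v) ∧
      ∀ w₁ ∈ W, ∀ w₂ ∈ W, w₁ ++ w₂ <:+: v}
  have hcomp : ∀ x : X, ∃ v ∈ V, Compatible T U x v := by
    intro x
    obtain ⟨n, hnN, hn⟩ := hN x
    obtain ⟨l, hl, h₁, h₂, h₃⟩ := exists_compatible_flatten hW.nil_notMem hW.exists_compatible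
      (fun w hw => hm (mem_image_of_mem _ hw)) x n
    refine ⟨l.flatten ++ a.flatten, ⟨?_, ⟨l ++ a, ?_, by simp⟩, ?_⟩, h₃.append ?_⟩
    · rw [List.length_append]; omega
    · intro w hw
      rcases List.mem_append.1 hw with hw | hw
      exacts [hl w hw, ha w hw]
    · exact fun w₁ h₁ w₂ h₂ => (hpairs w₁ h₁ w₂ h₂).trans (List.suffix_append _ _).isInfix
    · intro i hi
      have hlt : i < a.flatten.length := (List.getElem?_eq_some_iff.1 hi).1
      rw [← iterate_add_apply]
      have := hn (i + l.flatten.length - n) (by omega)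
      rwa [show n + (i + l.flatten.length - n) = i + l.flatten.length by omega] at this
  refine ⟨V, ⟨?_, ?_, ?_, hcomp⟩, fun v hv => hv.2⟩
  · exact (List.finite_length_le Bool (N + m + a.flatten.length)).subset fun v hv => hv.1
  · obtain ⟨v, hv, -⟩ := hcomp (Classical.arbitrary X)
    exact ⟨v, hv⟩
  · intro hv
    obtain ⟨w, hw⟩ := hW.nonempty
    have h := hv.2.2 w hw w hw
    rw [List.infix_nil, List.append_eq_nil_iff] at h
    exact hW.nil_notMem (h.1 ▸ hw)

lemma isCode_singletons : IsCode T U {[false], [true]} where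
  finite := by simp
  nonempty := by simp
  nil_notMem := by simp
  exists_compatible x := ⟨[false], by simp, fun i hi => by
    cases i <;> simp at hi⟩

lemma exists_mem_substShift_compatible {W : ℕ → Set (List Bool)}
    (hW : ∀ k, Refines (W k) (W (k + 1))) (hcode : ∀ k, IsCode T U (W k)) (x : X) :
    ∃ η ∈ substShift W, ∀ n : ℕ, η n = true → T^[n] x ∉ U := by
  let C : ℕ → Set (ℕ → Bool) := fun n =>
    {η | IsLegal (W n) (seqPrefix η n) ∧ Compatible T U x (seqPrefix η n)}
  have hcl : ∀ n, IsClosed (C n) := fun n =>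
    isClosed_setOf_seqPrefix n fun u => IsLegal (W n) u ∧ Compatible T U x u
  obtain ⟨η, hη⟩ := IsCompact.nonempty_iInter_of_sequence_nonempty_isCompact_isClosed C
    (fun n η hη => ⟨(hη.1.of_refines (hW n)).of_infix
      (seqPrefix_prefix η n.le_succ).isInfix, hη.2.of_prefix (seqPrefix_prefix η n.le_succ)⟩)
    (fun n => by
      obtain ⟨m, hm⟩ := ((hcode n).finite.image List.length).bddAbove
      obtain ⟨l, hl, hn, -, hx⟩ := exists_compatible_flatten (hcode n).nil_notMem
        (hcode n).exists_compatible (fun w hw => hm (mem_image_of_mem _ hw)) x n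
      have hpre : seqPrefix (fun i => l.flatten.getD i false) n <+: l.flatten := by
        rw [List.prefix_iff_getElem?]
        intro i hi
        rw [length_seqPrefix] at hi
        have hil : i < l.flatten.length := by omega
        simp [seqPrefix, List.getD_eq_getElem?_getD, List.getElem?_eq_getElem hil]
      exact ⟨fun i => l.flatten.getD i false, ⟨l, hl, hpre.isInfix⟩, hx.of_prefix hpre⟩)
    (hcl 0).isCompact hcl
  rw [mem_iInter] at hη
  exact ⟨η, fun n => (hη n).1, fun n hn =>
    (hη (n + 1)).2 n (by rw [getElem?_seqPrefix η n.lt_succ_self, hn])⟩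

/-- If every orbit stays outside `U` for long runs of times with bounded gaps, then some minimal
subshift, not consisting of the zero sequence, has for each point `x` an element supported outside
the visiting times of `x` to `U`. -/
lemma exists_minimal_subshift_avoiding [Nonempty X]
    (hU : ∀ L : ℕ, ∃ N : ℕ, ∀ x : X, ∃ n ≤ N, ∀ i < L, T^[n + i] x ∉ U) :
    ∃ K : Set (ℕ → Bool), IsClosed K ∧ MapsTo seqShift K K ∧
      (∀ η ∈ K, ∀ ζ ∈ K, ζ ∈ closure (orbit seqShift η)) ∧ (∃ η ∈ K, η 0 = true) ∧
      ∀ x : X, ∃ η ∈ K, ∀ n : ℕ, η n = true → T^[n] x ∉ U := by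
  have hstep : ∀ W : {W // IsCode T U W}, ∃ V : {W // IsCode T U W}, Refines W.1 V.1 := by
    rintro ⟨W, hW⟩
    obtain ⟨V, hV, hWV⟩ := hW.exists_refines hU
    exact ⟨⟨V, hV⟩, hWV⟩
  choose f hf using hstep
  let W : ℕ → {W // IsCode T U W} := fun n => f^[n] ⟨_, isCode_singletons⟩
  have hW : ∀ k, Refines (W k).1 (W (k + 1)).1 := fun k => by
    have : W (k + 1) = f (W k) := iterate_succ_apply' f k _
    rw [this]
    exact hf (W k)
  have hmem := exists_mem_substShift_compatible (T := T) (U := U) hW fun k => (W k).2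
  refine ⟨substShift fun k => (W k).1, isClosed_substShift, mapsTo_seqShift hW,
    fun η hη ζ hζ => mem_closure_orbit_seqShift hW (fun k => (W k).2.finite)
      (fun k => (W k).2.nonempty) (fun k => (W k).2.nil_notMem) hη hζ, ?_, hmem⟩
  obtain ⟨η, hη, -⟩ := hmem (Classical.arbitrary X)
  obtain ⟨n, hn⟩ := exists_pair_infix_seqPrefix hW (fun k => (W k).2.finite) hη 0
  have htrue : [true] ∈ (W 0).1 := by simp [W]
  obtain ⟨m, hm⟩ := exists_of_infix_seqPrefix (hn _ htrue _ htrue)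
  refine ⟨seqShift^[m] η, (mapsTo_seqShift hW).iterate m hη, ?_⟩
  rw [iterate_seqShift]
  simpa using (hm 0 (by simp)).symm

end Coding

section Disjointness

lemma IsMinimalSys.surjective {Y : Type*} [TopologicalSpace Y] [CompactSpace Y] [T2Space Y]
    {S : Y → Y} (hS : Continuous S) (hmin : IsMinimalSys S) : Function.Surjective S := by
  intro y
  have hcl : IsClosed (range S) := (isCompact_range hS).isClosed
  exact mem_of_mem_closure_orbit hcl (fun z _ => mem_range_self z) (mem_range_self y)
    (hmin (S y) y)

lemma isMinimalSys_restrict {Z : Type*} [TopologicalSpace Z] {S : Z → Z} {K : Set Z}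
    (hSK : MapsTo S K K) (hK : ∀ a ∈ K, ∀ b ∈ K, b ∈ closure (orbit S a)) :
    IsMinimalSys (hSK.restrict S K K) := by
  intro a b
  rw [closure_subtype]
  refine closure_mono ?_ (hK a a.2 b b.2)
  rintro _ ⟨n, rfl⟩
  refine ⟨(hSK.restrict S K K)^[n] a, ⟨n, rfl⟩, ?_⟩
  rw [hSK.iterate_restrict]
  rfl

variable {X : Type} [MetricSpace X] [CompactSpace X] {T : X → X}

omit [CompactSpace X] in
/-- Disjointness from all minimal systems, applied to a minimal closed subset of a compact
metrizable space. -/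
lemma disjointSys_restrict (hdisj : ∀ 𝒴 : TDS, IsMinimalSys 𝒴.map → DisjointSys T 𝒴.map)
    {Z : Type} [TopologicalSpace Z] [CompactSpace Z] [TopologicalSpace.MetrizableSpace Z] {S : Z → Z}
    (hS : Continuous S) {K : Set Z} (hKc : IsClosed K) (hSK : MapsTo S K K)
    (hK : ∀ a ∈ K, ∀ b ∈ K, b ∈ closure (orbit S a)) :
    DisjointSys T (hSK.restrict S K K) := by
  have hmin := isMinimalSys_restrict hSK hK
  have hcK : CompactSpace K := isCompact_iff_compactSpace.1 hKc.isCompact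
  let : MetricSpace K := TopologicalSpace.metrizableSpaceMetric K
  have hc : Continuous (hSK.restrict S K K) := hS.continuousOn.mapsToRestrict hSK
  exact hdisj ⟨K, hSK.restrict S K K, hc, hmin.surjective hc⟩ hmin

lemma IsMinimalPoint.mem_closure_orbit {Z : Type*} [TopologicalSpace Z] {S : Z → Z}
    {x : Z} (hx : IsMinimalPoint S x) :
    ∀ a ∈ closure (orbit S x), ∀ b ∈ closure (orbit S x), b ∈ closure (orbit S a) :=
  fun a ha _ hb => hx a ha hb

lemma exists_runs_avoiding (hT : Continuous T) {F : Set X} (hF : IsClosed F)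
    (hmin : ∀ x ∈ F, ¬ IsMinimalPoint T x) (L : ℕ) :
    ∃ N : ℕ, ∀ x : X, ∃ n ≤ N, ∀ i < L, T^[n + i] x ∉ F := by
  let O : ℕ → Set X := fun n => ⋂ i ∈ Finset.range L, {x | T^[n + i] x ∉ F}
  have hO : ∀ n, IsOpen (O n) := fun n => isOpen_biInter_finset fun i _ =>
    hF.isOpen_compl.preimage (hT.iterate (n + i))
  have hcover : (univ : Set X) ⊆ ⋃ n, O n := by
    intro x _
    obtain ⟨z, hz, hzmin⟩ := exists_isMinimalPoint_mem hT (isClosed_closure (s := orbit T x))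
      ⟨x, subset_closure (self_mem_orbit T x)⟩ (mapsTo_closure_orbit hT x)
    have hzO : z ∈ O 0 := by
      simp only [O, mem_iInter, mem_ofPred_eq]
      intro i _ hi
      refine hmin _ hi fun y hy => ?_
      have hsub : closure (orbit T (T^[0 + i] z)) ⊆ closure (orbit T z) := fun w hw =>
        mem_of_mem_closure_orbit isClosed_closure (mapsTo_closure_orbit hT z)
          (subset_closure ⟨0 + i, rfl⟩) hw
      exact hsub.trans (hzmin y (hsub hy))
    obtain ⟨_, hn, n, rfl⟩ := mem_closure_iff.1 hz _ (hO 0) hzO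
    simp only [O, mem_iInter, mem_ofPred_eq] at hn
    simp only [O, mem_iUnion, mem_iInter, mem_ofPred_eq]
    refine ⟨n, fun i hi => ?_⟩
    have := hn i hi
    rwa [← iterate_add_apply, zero_add, add_comm] at this
  obtain ⟨t, ht⟩ := isCompact_univ.elim_finite_subcover O hO hcover
  refine ⟨t.sup id, fun x => ?_⟩
  obtain ⟨n, hn, hx⟩ := mem_iUnion₂.1 (ht (mem_univ x))
  simp only [O, mem_iInter, mem_ofPred_eq, Finset.mem_range] at hx
  exact ⟨n, Finset.le_sup (f := id) hn, hx⟩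

lemma dense_setOf_isMinimalPoint (hT : Continuous T) (hTtr : IsTransitiveSys T)
    (hdisj : ∀ 𝒴 : TDS, IsMinimalSys 𝒴.map → DisjointSys T 𝒴.map) :
    Dense {x | IsMinimalPoint T x} := by
  by_contra hnd
  obtain ⟨x₀, hx₀⟩ : ∃ x, x ∉ closure {x | IsMinimalPoint T x} := by
    by_contra! h
    exact hnd h
  obtain ⟨F, hFn, hFc, hF⟩ := exists_mem_nhds_isClosed_subset
    (isClosed_closure.isOpen_compl.mem_nhds hx₀)
  have hruns := exists_runs_avoiding hT hFc
    (fun x hx hxm => hF hx (subset_closure hxm))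
  have : Nonempty X := ⟨x₀⟩
  obtain ⟨K, hKc, hK, hKmin, ⟨η, hηK, hη⟩, hKx⟩ := exists_minimal_subshift_avoiding hruns
  have hσ : Continuous (seqShift : (ℕ → Bool) → ℕ → Bool) :=
    continuous_pi fun i => continuous_apply (i + 1)
  have hcK : CompactSpace K := isCompact_iff_compactSpace.1 hKc.isCompact
  have hV : IsOpen {ζ : K | ζ.1 0 = true} :=
    (isOpen_discrete ({true} : Set Bool)).preimage
      (f := fun ζ : K => ζ.1 0)
      ((continuous_apply (A := fun _ : ℕ => Bool) 0).comp continuous_subtype_val)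
  refine (disjointSys_restrict hdisj hσ hKc hK hKmin).not_subset_closure hT
    (hσ.continuousOn.mapsToRestrict hK) hTtr (isMinimalSys_restrict hK hKmin)
    isOpen_interior hV ⟨x₀, mem_interior_iff_mem_nhds.2 hFn⟩ ⟨⟨η, hηK⟩, hη⟩ isOpen_univ
    univ_nonempty fun x _ => subset_closure ?_
  obtain ⟨ζ, hζK, hζ⟩ := hKx x
  refine ⟨⟨ζ, hζK⟩, fun n hn => hζ n ?_ (interior_subset hn.1)⟩
  have h := hn.2
  rw [hK.iterate_restrict] at h
  have h' : (seqShift^[n] ζ) 0 = true := h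
  rwa [iterate_seqShift] at h'

lemma exists_return_and_visit (hT : Continuous T) (hTtr : IsTransitiveSys T)
    (hdisj : ∀ 𝒴 : TDS, IsMinimalSys 𝒴.map → DisjointSys T 𝒴.map)
    {U V : Set X} (hU : IsOpen U) (hV : IsOpen V) (hUn : U.Nonempty) (hVn : V.Nonempty) :
    ∃ n : ℕ, (U ∩ T^[n] ⁻¹' U).Nonempty ∧ (U ∩ T^[n] ⁻¹' V).Nonempty := by
  obtain ⟨m, hm, hmU⟩ := (dense_setOf_isMinimalPoint hT hTtr hdisj).exists_mem_open hU hUn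
  have hM := mapsTo_closure_orbit hT m
  have hmM := subset_closure (self_mem_orbit T m)
  have hcM : CompactSpace (closure (orbit T m)) :=
    isCompact_iff_compactSpace.1 isClosed_closure.isCompact
  by_contra! hcon
  refine (disjointSys_restrict hdisj hT isClosed_closure hM
    hm.mem_closure_orbit).not_subset_closure hT (hT.continuousOn.mapsToRestrict hM) hTtr
    (isMinimalSys_restrict hM hm.mem_closure_orbit) hV
    (hU.preimage continuous_subtype_val) hVn ⟨⟨m, hmM⟩, hmU⟩ hU hUn
    fun x hx => subset_closure ⟨⟨m, hmM⟩, fun n hn => ?_⟩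
  have h := hn.2
  rw [hM.iterate_restrict] at h
  have hempty := hcon n ⟨m, hmU, h⟩
  exact hempty.subset ⟨hx, hn.1⟩

lemma isWeaklyMixingSys_of_exists_return_and_visit {X : Type*} [TopologicalSpace X] {T : X → X}
    (hT : Continuous T) (hTs : Function.Surjective T) (hTtr : IsTransitiveSys T)
    (h : ∀ U V : Set X, IsOpen U → IsOpen V → U.Nonempty → V.Nonempty →
      ∃ n : ℕ, (U ∩ T^[n] ⁻¹' U).Nonempty ∧ (U ∩ T^[n] ⁻¹' V).Nonempty) :
    IsWeaklyMixingSys T := by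
  have hpre : ∀ (n : ℕ) {V : Set X}, IsOpen V → V.Nonempty →
      IsOpen (T^[n] ⁻¹' V) ∧ (T^[n] ⁻¹' V).Nonempty := fun n V hV hVn =>
    ⟨hV.preimage (hT.iterate n), hVn.preimage (hTs.iterate n)⟩
  have hcommon : ∀ (b : ℕ) {W V V' : Set X}, IsOpen W → IsOpen V → IsOpen V' → W.Nonempty →
      V.Nonempty → V'.Nonempty →
      ∃ n > b, (W ∩ T^[n] ⁻¹' V).Nonempty ∧ (W ∩ T^[n] ⁻¹' V').Nonempty := by
    intro b W V V' hW hV hV' hWn hVn hVn'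
    obtain ⟨k, hk, hkb⟩ := (hTtr W V hW hV hWn hVn).exists_gt b
    obtain ⟨hV1, hV1n⟩ := hpre k hV' hVn'
    obtain ⟨m, ⟨x, hx, hmx⟩, ⟨y, hy, hmy⟩⟩ :=
      h _ _ (hW.inter (hpre k hV hVn).1) hV1 hk hV1n
    refine ⟨k + m, by omega, ⟨x, hx.1, ?_⟩, ⟨y, hy.1, ?_⟩⟩
    · rw [mem_preimage, iterate_add_apply]; exact hmx.2
    · rw [mem_preimage, iterate_add_apply]; exact hmy
  have hiter : ∀ (n : ℕ) (p : X × X),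
      (fun p : X × X => (T p.1, T p.2))^[n] p = (T^[n] p.1, T^[n] p.2) := fun n p =>
    congrFun (Prod.map_iterate T T n) p
  intro A B hA hB ⟨a, ha⟩ ⟨b, hb⟩
  obtain ⟨U₁, U₂, hU₁, hU₂, ha₁, ha₂, hUA⟩ := isOpen_prod_iff.1 hA a.1 a.2 ha
  obtain ⟨V₁, V₂, hV₁, hV₂, hb₁, hb₂, hVB⟩ := isOpen_prod_iff.1 hB b.1 b.2 hb
  refine Set.infinite_of_forall_exists_gt fun N => ?_
  obtain ⟨n, hn⟩ := (hTtr U₁ U₂ hU₁ hU₂ ⟨_, ha₁⟩ ⟨_, ha₂⟩).nonempty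
  obtain ⟨hV₂', hV₂n'⟩ := hpre n hV₂ ⟨_, hb₂⟩
  obtain ⟨m, hmN, ⟨x, hx, hmx⟩, ⟨y, hy, hmy⟩⟩ := hcommon N
    (hU₁.inter (hU₂.preimage (hT.iterate n))) hV₁ hV₂' hn ⟨_, hb₁⟩ hV₂n'
  refine ⟨m, ⟨(x, T^[n] y), hUA ⟨hx.1, hy.2⟩, ?_⟩, hmN⟩
  rw [mem_preimage, hiter]
  refine hVB ⟨hmx, ?_⟩
  rw [← iterate_add_apply, add_comm, iterate_add_apply]
  exact hmy

end Disjointness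

theorem stmt_6 {X : Type} [MetricSpace X] [CompactSpace X] (T : X → X)
    (hTc : Continuous T) (hTs : Function.Surjective T) (hTtr : IsTransitiveSys T)
    (hdisj : ∀ 𝒴 : TDS, IsMinimalSys 𝒴.map → DisjointSys T 𝒴.map) :
    IsWeaklyMixingSys T ∧ ∃ D : Set X, D.Countable ∧ Dense D ∧
      ∀ U : Set X, IsOpen U → U.Nonempty →
        ∀ B : Set ℕ, DynSyndetic B →
          ∃ x ∈ D ∩ U, ∀ A : Set ℕ, Thick A →
            ({n : ℕ | T^[n] x ∈ U} ∩ (A ∩ B)).Nonempty := by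
  obtain ⟨D, hDmin, hDc, hDd⟩ :=
    (dense_setOf_isMinimalPoint hTc hTtr hdisj).exists_countable_dense_subset
  refine ⟨isWeaklyMixingSys_of_exists_return_and_visit hTc hTs hTtr
    fun U V hU hV hUn hVn => exists_return_and_visit hTc hTtr hdisj hU hV hUn hVn,
    D, hDc, hDd, fun U hU hUn B hB => ?_⟩
  obtain ⟨𝒴, hmin, y, V, hV, hyV, hVB⟩ := hB
  by_contra! hcon
  refine (hdisj 𝒴 hmin).not_subset_closure hTc 𝒴.cont hTtr hmin hU hV hUn ⟨y, hyV⟩ hU hUn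
    ((hDd.open_subset_closure_inter hU).trans (closure_mono fun x hx => ?_))
  obtain ⟨A, hA, hempty⟩ := hcon x hx.symm
  exact IsMinimalPoint.exists_avoid hTc 𝒴.cont (hDmin hx.2) hU hV hA
    fun n hn hxy => hempty.subset ⟨hxy.1, hn, hVB hxy.2⟩
end

section
/- Let (X,T) be a weakly mixing topological dynamical system whose set of distal points is dense in X. Then (X,T) is disjoint from every minimal topological dynamical system. -/
open Set Function Filter Topology

attribute [local instance] Ultrafilter.addSemigroup

section WeakMixing

variable {X : Type*}

theorem iterate_prodMap_apply {X Y : Type*} (T : X → X) (S : Y → Y) (n : ℕ) (p : X × Y) :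
    (fun p : X × Y => (T p.1, S p.2))^[n] p = (T^[n] p.1, S^[n] p.2) := by
  induction n generalizing p with
  | zero => rfl
  | succ n ih => simp [Function.iterate_succ, ih]

/-- Furstenberg's intersection lemma for the hitting time sets of a weakly mixing system. -/
theorem IsWeaklyMixingSys.exists_hitting_subset [TopologicalSpace X] {T : X → X}
    (hTc : Continuous T) (hT : IsWeaklyMixingSys T) {A B C D : Set X}
    (hA : IsOpen A) (hB : IsOpen B) (hC : IsOpen C) (hD : IsOpen D)
    (hA' : A.Nonempty) (hB' : B.Nonempty) (hC' : C.Nonempty) (hD' : D.Nonempty) :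
    ∃ E F : Set X, IsOpen E ∧ IsOpen F ∧ E.Nonempty ∧ F.Nonempty ∧
      ∀ k : ℕ, (E ∩ T^[k] ⁻¹' F).Nonempty →
        (A ∩ T^[k] ⁻¹' C).Nonempty ∧ (B ∩ T^[k] ⁻¹' D).Nonempty := by
  obtain ⟨n, ⟨a, c⟩, ⟨ha, hc⟩, hn⟩ := (hT (A ×ˢ C) (B ×ˢ D) (hA.prod hC) (hB.prod hD)
    (hA'.prod hC') (hB'.prod hD')).nonempty
  rw [mem_preimage, iterate_prodMap_apply] at hn
  refine ⟨A ∩ T^[n] ⁻¹' B, C ∩ T^[n] ⁻¹' D, hA.inter (hB.preimage (hTc.iterate n)),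
    hC.inter (hD.preimage (hTc.iterate n)), ⟨a, ha, hn.1⟩, ⟨c, hc, hn.2⟩, ?_⟩
  rintro k ⟨e, ⟨heA, heB⟩, heC, heD⟩
  refine ⟨⟨e, heA, heC⟩, T^[n] e, heB, ?_⟩
  rw [mem_preimage, ← Function.iterate_add_apply, add_comm, Function.iterate_add_apply]
  exact heD

theorem IsWeaklyMixingSys.exists_common_hitting_time [TopologicalSpace X] {T : X → X}
    (hTc : Continuous T) (hT : IsWeaklyMixingSys T) {ι : Type*} (s : Finset ι)
    {U : Set X} (hU : IsOpen U) (hU' : U.Nonempty) (V : ι → Set X)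
    (hV : ∀ i ∈ s, IsOpen (V i)) (hV' : ∀ i ∈ s, (V i).Nonempty) :
    ∃ n : ℕ, ∀ i ∈ s, (U ∩ T^[n] ⁻¹' V i).Nonempty := by
  classical
  have key : ∃ E F : Set X, IsOpen E ∧ IsOpen F ∧ E.Nonempty ∧ F.Nonempty ∧
      ∀ k : ℕ, (E ∩ T^[k] ⁻¹' F).Nonempty → ∀ i ∈ s, (U ∩ T^[k] ⁻¹' V i).Nonempty := by
    induction s using Finset.induction_on with
    | empty => exact ⟨U, U, hU, hU, hU', hU', by simp⟩
    | insert a s _ ih =>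
      simp only [Finset.forall_mem_insert] at hV hV'
      obtain ⟨E, F, hE, hF, hE', hF', h⟩ := ih hV.2 hV'.2
      obtain ⟨E', F', h1, h2, h3, h4, h'⟩ :=
        hT.exists_hitting_subset hTc hU hE hV.1 hF hU' hE' hV'.1 hF'
      refine ⟨E', F', h1, h2, h3, h4, fun k hk => ?_⟩
      simp only [Finset.forall_mem_insert]
      exact ⟨(h' k hk).1, h k (h' k hk).2⟩
  obtain ⟨E, F, hE, hF, hE', hF', h⟩ := key
  have hne := hT (E ×ˢ E) (F ×ˢ F) (hE.prod hE) (hF.prod hF) (hE'.prod hE') (hF'.prod hF')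
  obtain ⟨n, ⟨e, e'⟩, ⟨he, -⟩, hn⟩ := hne.nonempty
  rw [mem_preimage, iterate_prodMap_apply] at hn
  exact ⟨n, h n ⟨e, he, hn.1⟩⟩

theorem IsWeaklyMixingSys.dense_setOf_exists_dist_lt [MetricSpace X] [CompactSpace X]
    {T : X → X} (hTc : Continuous T) (hT : IsWeaklyMixingSys T) (p : X) {ε : ℝ} (hε : 0 < ε) :
    Dense {x | ∃ n : ℕ, dist (T^[n] x) (T^[n] p) < ε} := by
  rw [dense_iff_inter_open]
  intro U hU hU'
  obtain ⟨t, -, htf, ht⟩ := finite_cover_balls_of_compact (isCompact_univ (X := X)) (half_pos hε)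
  obtain ⟨n, hn⟩ := hT.exists_common_hitting_time hTc htf.toFinset hU hU'
    (fun c => Metric.ball c (ε / 2)) (fun _ _ => Metric.isOpen_ball)
    (fun c _ => ⟨c, Metric.mem_ball_self (half_pos hε)⟩)
  obtain ⟨c, hc, hpc⟩ := mem_iUnion₂.1 (ht (mem_univ (T^[n] p)))
  obtain ⟨x, hxU, hx⟩ := hn c (htf.mem_toFinset.2 hc)
  refine ⟨x, hxU, n, ?_⟩
  have h1 : dist (T^[n] x) c < ε / 2 := hx
  have h2 : dist (T^[n] p) c < ε / 2 := hpc
  linarith [dist_triangle_right (T^[n] x) (T^[n] p) c]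

/-- In a weakly mixing system some point is proximal to all points of a countable set. -/
theorem IsWeaklyMixingSys.exists_forall_dist_lt [MetricSpace X] [CompactSpace X] [Nonempty X]
    {T : X → X} (hTc : Continuous T) (hT : IsWeaklyMixingSys T) {D : Set X} (hD : D.Countable) :
    ∃ x, ∀ p ∈ D, ∀ ε > 0, ∃ n : ℕ, dist (T^[n] x) (T^[n] p) < ε := by
  have h := dense_biInter_of_isOpen (S := D ×ˢ (univ : Set ℕ))
    (f := fun q => {x : X | ∃ n : ℕ, dist (T^[n] x) (T^[n] q.1) < 1 / ((q.2 : ℝ) + 1)})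
    (fun q _ => by
      simp only [ofPred_exists]
      exact isOpen_iUnion fun n =>
        isOpen_lt ((hTc.iterate n).dist continuous_const) continuous_const)
    (hD.prod countable_univ)
    (fun q _ => hT.dense_setOf_exists_dist_lt hTc q.1 Nat.one_div_pos_of_nat)
  obtain ⟨x, hx⟩ := h.nonempty
  refine ⟨x, fun p hp ε hε => ?_⟩
  obtain ⟨m, hm⟩ := exists_nat_one_div_lt hε
  obtain ⟨n, hn⟩ := mem_iInter₂.1 hx (p, m) ⟨hp, mem_univ _⟩
  exact ⟨n, lt_trans hn hm⟩

end WeakMixing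

section UltrafilterLimits

variable {X : Type*} [TopologicalSpace X] [T2Space X]

/-- The limit of the orbit of `x` along the ultrafilter `q`. -/
noncomputable def orbitLim (T : X → X) (q : Ultrafilter ℕ) (x : X) : X :=
  Ultrafilter.extend (fun n => T^[n] x) q

theorem orbitLim_pure (T : X → X) (n : ℕ) (x : X) : orbitLim T (pure n) x = T^[n] x :=
  ultrafilter_extend_pure _ n

variable [CompactSpace X]

theorem tendsto_orbitLim (T : X → X) (q : Ultrafilter ℕ) (x : X) :
    Tendsto (fun n => T^[n] x) q (𝓝 (orbitLim T q x)) :=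
  ultrafilter_extend_eq_iff.1 rfl

theorem continuous_orbitLim (T : X → X) (x : X) : Continuous fun q => orbitLim T q x :=
  continuous_ultrafilter_extend _

theorem orbitLim_add {T : X → X} (hT : Continuous T) (q r : Ultrafilter ℕ) (x : X) :
    orbitLim T (q + r) x = orbitLim T q (orbitLim T r x) := by
  refine ultrafilter_extend_eq_iff.2 ((nhds_basis_opens _).ge_iff.2 fun V hV => ?_)
  change ∀ᶠ n in ((q + r : Ultrafilter ℕ) : Filter ℕ), T^[n] x ∈ V
  rw [Ultrafilter.eventually_add]
  filter_upwards [(tendsto_orbitLim T q (orbitLim T r x)).eventually (hV.2.mem_nhds hV.1)]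
    with m hm
  have := ((hT.iterate m).tendsto _).comp (tendsto_orbitLim T r x)
  filter_upwards [this.eventually (hV.2.mem_nhds hm)] with k hk
  rwa [Function.iterate_add_apply]

theorem exists_orbitLim_eq {T : X → X} {x y : X} (hy : y ∈ closure (orbit T x)) :
    ∃ q, orbitLim T q x = y := by
  have hc : IsClosed (range fun q => orbitLim T q x) :=
    (isCompact_range (continuous_orbitLim T x)).isClosed
  refine closure_minimal ?_ hc hy
  rintro _ ⟨n, rfl⟩
  exact ⟨pure n, orbitLim_pure T n x⟩

theorem orbitLim_mem_closure (T : X → X) (q : Ultrafilter ℕ) (x : X) :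
    orbitLim T q x ∈ closure (orbit T x) :=
  mem_closure_of_tendsto (tendsto_orbitLim T q x) (Eventually.of_forall fun n => ⟨n, rfl⟩)

theorem exists_orbitLim_eq_orbitLim {X : Type*} [MetricSpace X] [CompactSpace X] {T : X → X}
    {x p : X} (h : ∀ ε > 0, ∃ n : ℕ, dist (T^[n] x) (T^[n] p) < ε) :
    ∃ q, orbitLim T q x = orbitLim T q p := by
  obtain ⟨q, hq⟩ := ((continuous_orbitLim T x).dist (continuous_orbitLim T p)).exists_forall_le'
    (x₀ := pure 0) (by simp)
  refine ⟨q, dist_le_zero.1 (le_of_forall_pos_le_add fun ε hε => ?_)⟩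
  obtain ⟨n, hn⟩ := h ε hε
  have := hq (pure n)
  rw [orbitLim_pure, orbitLim_pure] at this
  linarith

theorem proximal_of_orbitLim_eq {X : Type*} [MetricSpace X] [CompactSpace X] {T : X → X}
    {q : Ultrafilter ℕ} {x y : X} (h : orbitLim T q x = orbitLim T q y) : Proximal T x y := by
  have ht := (tendsto_orbitLim T q x).dist (tendsto_orbitLim T q y)
  rw [h, dist_self] at ht
  have hn : ∀ k : ℕ, ∃ n : ℕ, dist (T^[n] x) (T^[n] y) < 1 / ((k : ℝ) + 1) := fun k =>
    (ht.eventually (gt_mem_nhds Nat.one_div_pos_of_nat)).exists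
  choose u hu using hn
  exact ⟨u, squeeze_zero (fun _ => dist_nonneg) (fun k => (hu k).le)
    tendsto_one_div_add_atTop_nhds_zero_nat⟩

/-- If `x` is proximal to a distal point `p`, then `x` and any point `y` of a minimal system
can be moved simultaneously to `p` and `y`. -/
theorem IsDistalPoint.exists_orbitLim_eq {X Y : Type*} [MetricSpace X] [CompactSpace X]
    [TopologicalSpace Y] [CompactSpace Y] [T2Space Y] {T : X → X} {S : Y → Y}
    (hTc : Continuous T) (hSc : Continuous S) (hS : IsMinimalSys S) {p x : X}
    (hp : IsDistalPoint T p) (h : ∀ ε > 0, ∃ n : ℕ, dist (T^[n] x) (T^[n] p) < ε) (y : Y) :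
    ∃ q, orbitLim T q x = p ∧ orbitLim S q y = y := by
  let Q : Set (Ultrafilter ℕ) := {q | orbitLim T q x = orbitLim T q p ∧ orbitLim S q y = y}
  have hQ : IsClosed Q :=
    (isClosed_eq (continuous_orbitLim T x) (continuous_orbitLim T p)).inter
      (isClosed_eq (continuous_orbitLim S y) continuous_const)
  have hne : Q.Nonempty := by
    obtain ⟨q, hq⟩ := exists_orbitLim_eq_orbitLim h
    obtain ⟨r, hr⟩ := _root_.exists_orbitLim_eq (hS (orbitLim S q y) y)
    refine ⟨r + q, ?_, ?_⟩
    · rw [orbitLim_add hTc, orbitLim_add hTc, hq]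
    · rw [orbitLim_add hSc, hr]
  obtain ⟨u, ⟨hux, huy⟩, huu⟩ := exists_idempotent_in_compact_add_subsemigroup
    Ultrafilter.continuous_add_left Q hne hQ.isCompact (by
      rintro q ⟨hq, hq'⟩ r ⟨hr, hr'⟩
      refine ⟨?_, ?_⟩
      · rw [orbitLim_add hTc, orbitLim_add hTc, hr]
      · rw [orbitLim_add hSc, hr', hq'])
  refine ⟨u, ?_, huy⟩
  rw [hux]
  refine hp _ (orbitLim_mem_closure T u p) (proximal_of_orbitLim_eq (q := u) ?_)
  rw [← orbitLim_add hTc, huu]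

end UltrafilterLimits

theorem iterate_mem_of_invariant {X Y : Type*} {T : X → X} {S : Y → Y} {J : Set (X × Y)}
    (hJ : ∀ p ∈ J, (T p.1, S p.2) ∈ J) {x : X} {y : Y} (h : (x, y) ∈ J) (n : ℕ) :
    (T^[n] x, S^[n] y) ∈ J := by
  induction n with
  | zero => exact h
  | succ n ih =>
    rw [Function.iterate_succ_apply', Function.iterate_succ_apply']
    exact hJ _ ih

theorem stmt_9 {X : Type} [MetricSpace X] [CompactSpace X] (T : X → X)
    (hTc : Continuous T) (hTs : Function.Surjective T) (hTwm : IsWeaklyMixingSys T)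
    (hdense : Dense {x : X | IsDistalPoint T x}) :
    ∀ 𝒴 : TDS, IsMinimalSys 𝒴.map → DisjointSys T 𝒴.map := by
  rintro 𝒴 hS J ⟨⟨z, -⟩, hJc, hJi, hJ₁, -⟩
  have : Nonempty X := ⟨z.1⟩
  obtain ⟨D, hD, hDc, hDd⟩ := hdense.exists_countable_dense_subset
  obtain ⟨x, hx⟩ := hTwm.exists_forall_dist_lt hTc hDc
  obtain ⟨⟨x, y⟩, hxy, rfl : _ = _⟩ : x ∈ Prod.fst '' J := hJ₁ ▸ mem_univ x
  have hDy : ∀ p ∈ D, (p, y) ∈ J := by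
    intro p hp
    obtain ⟨q, hqx, hqy⟩ := (hD hp).exists_orbitLim_eq (x := x) hTc 𝒴.cont hS (hx p hp) y
    have ht := (tendsto_orbitLim T q x).prodMk_nhds (tendsto_orbitLim 𝒴.map q y)
    rw [hqx, hqy] at ht
    exact hJc.mem_of_tendsto ht
      (Eventually.of_forall fun n => iterate_mem_of_invariant hJi hxy n)
  have hXy : ∀ p, (p, y) ∈ J := fun p =>
    closure_minimal hDy (hJc.preimage (Continuous.prodMk_left y)) (hDd p)
  refine eq_univ_of_forall fun ⟨p, w⟩ => ?_
  refine closure_minimal (t := {w | (p, w) ∈ J}) ?_ (hJc.preimage (Continuous.prodMk_right p))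
    (hS y w)
  rintro _ ⟨n, rfl⟩
  obtain ⟨p', rfl⟩ := hTs.iterate n p
  exact iterate_mem_of_invariant hJi (hXy p') n
end
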